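/- Let π, σ, τ be permutations of Fin n. Pushing setoids forward along the bijection of Fin n ⊕ Fin n given by inl x ↦ inl x and inr y ↦ inr (π y) restricts to a bijection from the set of propagating setoids r on Fin n ⊕ Fin n satisfying G(σ) ≤ r and G(τ) ≤ r onto the set of propagating setoids r satisfying G(π * σ) ≤ r and G(π * τ) ≤ r, where π * σ denotes the product in the symmetric group (apply σ first, then π). -/

import Mathlib

/-- The setoid on `Fin n ⊕ Fin n` generated by the pairs `inl x ≈ inr (σ x)`,
for `σ` a permutation of `Fin n`. -/
def permSetoid {n : ℕ} (σ : Equiv.Perm (Fin n)) : Setoid (Fin n ⊕ Fin n) :=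
  Relation.EqvGen.setoid (fun a b => ∃ x : Fin n, a = Sum.inl x ∧ b = Sum.inr (σ x))

/-- A setoid on `Fin n ⊕ Fin n` is propagating if every equivalence class contains
an element of the left summand and an element of the right summand. -/
def Propagating {n : ℕ} (r : Setoid (Fin n ⊕ Fin n)) : Prop :=
  ∀ a : Fin n ⊕ Fin n,
    (∃ x : Fin n, r a (Sum.inl x)) ∧ (∃ y : Fin n, r a (Sum.inr y))

/-- The pushforward of a setoid `r` along a bijection `e`: it relates `e a` and `e b`
iff `r` relates `a` and `b`. -/
def pushSetoid {X : Type*} (e : X ≃ X) (r : Setoid X) : Setoid X :=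
  Setoid.comap (fun x => e.symm x) r

theorem permSetoid_le_iff {n : ℕ} (σ : Equiv.Perm (Fin n)) (r : Setoid (Fin n ⊕ Fin n)) :
    permSetoid σ ≤ r ↔ ∀ x, r (Sum.inl x) (Sum.inr (σ x)) := by
  constructor
  · exact fun h x => h (Relation.EqvGen.rel _ _ ⟨x, rfl, rfl⟩)
  · intro h a b hab
    change Relation.EqvGen _ a b at hab
    induction hab with
    | rel a b hab =>
      obtain ⟨x, rfl, rfl⟩ := hab
      exact h x
    | refl a => exact r.refl a
    | symm a b _ ih => exact r.symm ih
    | trans a b c _ _ ihab ihbc => exact r.trans ihab ihbc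

theorem pushSetoid_rel {X : Type*} (e : X ≃ X) (r : Setoid X) (a b : X) :
    pushSetoid e r a b ↔ r (e.symm a) (e.symm b) :=
  Iff.rfl

theorem pushSetoid_symm_pushSetoid {X : Type*} (e : X ≃ X) (r : Setoid X) :
    pushSetoid e.symm (pushSetoid e r) = r := by
  ext a b
  simp [pushSetoid_rel]

theorem pushSetoid_pushSetoid_symm {X : Type*} (e : X ≃ X) (r : Setoid X) :
    pushSetoid e (pushSetoid e.symm r) = r :=
  pushSetoid_symm_pushSetoid e.symm r

theorem Propagating.pushSetoid_sumCongr {n : ℕ} {r : Setoid (Fin n ⊕ Fin n)}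
    (h : Propagating r) (ρ π : Equiv.Perm (Fin n)) :
    Propagating (pushSetoid (Equiv.sumCongr ρ π) r) := by
  intro a
  obtain ⟨⟨x, hx⟩, ⟨y, hy⟩⟩ := h ((Equiv.sumCongr ρ π).symm a)
  exact ⟨⟨ρ x, by simpa [pushSetoid_rel] using hx⟩, ⟨π y, by simpa [pushSetoid_rel] using hy⟩⟩

theorem permSetoid_mul_le_pushSetoid_iff {n : ℕ} (π σ : Equiv.Perm (Fin n))
    (r : Setoid (Fin n ⊕ Fin n)) :
    permSetoid (π * σ) ≤ pushSetoid (Equiv.sumCongr (Equiv.refl (Fin n)) π) r ↔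
      permSetoid σ ≤ r := by
  simp [permSetoid_le_iff, pushSetoid_rel]

/-- Pushing setoids forward along the bijection `inl x ↦ inl x`, `inr y ↦ inr (π y)`
restricts to a bijection from the propagating setoids containing `G σ` and `G τ` onto
the propagating setoids containing `G (π * σ)` and `G (π * τ)`. -/
theorem pushSetoid_left_bijOn {n : ℕ} (π σ τ : Equiv.Perm (Fin n)) :
    Set.BijOn (pushSetoid (Equiv.sumCongr (Equiv.refl (Fin n)) (π : Equiv.Perm (Fin n))))
      {r : Setoid (Fin n ⊕ Fin n) | Propagating r ∧ permSetoid σ ≤ r ∧ permSetoid τ ≤ r}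
      {r : Setoid (Fin n ⊕ Fin n) |
        Propagating r ∧ permSetoid (π * σ) ≤ r ∧ permSetoid (π * τ) ≤ r} := by
  set e := Equiv.sumCongr (Equiv.refl (Fin n)) π
  refine Set.InvOn.bijOn (f' := pushSetoid e.symm)
    ⟨fun r _ => pushSetoid_symm_pushSetoid e r, fun r _ => pushSetoid_pushSetoid_symm e r⟩ ?_ ?_
  · rintro r ⟨hr, hσ, hτ⟩
    exact ⟨hr.pushSetoid_sumCongr _ π, (permSetoid_mul_le_pushSetoid_iff π σ r).2 hσ,
      (permSetoid_mul_le_pushSetoid_iff π τ r).2 hτ⟩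
  · rintro r ⟨hr, hσ, hτ⟩
    rw [← pushSetoid_pushSetoid_symm e r] at hσ hτ
    exact ⟨hr.pushSetoid_sumCongr _ π.symm, (permSetoid_mul_le_pushSetoid_iff π σ _).1 hσ,
      (permSetoid_mul_le_pushSetoid_iff π τ _).1 hτ⟩
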